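/- Let Ω₀ ⊆ ℂ be a simply connected domain and let F₀ + conj(G₀) be a univalent, sense preserving harmonic mapping on Ω₀ such that F₀' and G₀' are linearly independent over ℂ. Suppose F(t,·), G(t,·) are holomorphic on Ω₀ for each t ≥ 0, with C¹ dependence on t, that F(0,·) = F₀ and G(0,·) = G₀, and that f = ∂F/∂z, g = ∂G/∂z satisfy the governing equation f_t(t,z)·conj(f(t,z)) − g(t,z)·conj(g_t(t,z)) = i·ν(z, conj(z)) for some time-independent real-valued function ν on Ω₀, with f(t,·) and g(t,·) not identically zero. Then either (i) there exist a C¹ function β : [0,∞) → ℂ with β(0) = 0 and a real constant ν₀ such that, setting Φ(t) = ∫₀ᵗ (ν₀ + Im{β'(s)·conj(β(s))}) / (1 + |β(s)|²) ds, one has f(t,z) = √(1 + |β(t)|²)·e^{iΦ(t)}·F₀'(z) + β(t)·G₀'(z) and g(t,z) = conj(β(t))·F₀'(z) + √(1 + |β(t)|²)·e^{−iΦ(t)}·G₀'(z) for all t ≥ 0 and z ∈ Ω₀; or (ii) there exist a real constant ν₀ and a nonzero real constant ξ₀ such that f(t,z) = e^{iν₀t}·F₀'(z) and g(t,z) = e^{i(ξ₀−ν₀)t}·G₀'(z)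 for all t ≥ 0 and z ∈ Ω₀. -/

import Mathlib

open Set

open ComplexConjugate in
/-- The holomorphic Wirtinger derivative of a vanishing sum `∑ φₖ conj ψₖ` vanishes. -/
lemma sum_deriv_mul_conj_eq_zero {ι : Type*} [Fintype ι] {Ω : Set ℂ} (hΩ : IsOpen Ω)
    {φ ψ : ι → ℂ → ℂ} (hφ : ∀ k, DifferentiableOn ℂ (φ k) Ω)
    (hψ : ∀ k, DifferentiableOn ℂ (ψ k) Ω)
    (h : ∀ z ∈ Ω, ∑ k, φ k z * conj (ψ k z) = 0) :
    ∀ z ∈ Ω, ∑ k, deriv (φ k) z * conj (ψ k z) = 0 := by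
  intro z hz
  have hdir : ∀ v : ℂ, v * (∑ k, deriv (φ k) z * conj (ψ k z))
      + conj v * (∑ k, φ k z * conj (deriv (ψ k) z)) = 0 := by
    intro v
    have hline : HasDerivAt (fun s : ℝ => z + (s : ℂ) * v) v 0 := by
      simpa using ((Complex.ofRealCLM.hasDerivAt (x := (0 : ℝ))).mul_const v).const_add z
    have hcomp : ∀ {χ : ℂ → ℂ}, DifferentiableOn ℂ χ Ω →
        HasDerivAt (fun s : ℝ => χ (z + (s : ℂ) * v)) (deriv χ z * v) 0 := by
      intro χ hχ
      have h1 : HasDerivAt χ (deriv χ z) (z + ((0 : ℝ) : ℂ) * v) := by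
        simpa using (hχ.differentiableAt (hΩ.mem_nhds hz)).hasDerivAt
      exact h1.comp (0 : ℝ) hline
    have hsum : HasDerivAt (fun s : ℝ => ∑ k, φ k (z + (s : ℂ) * v) * conj (ψ k (z + (s : ℂ) * v)))
        (∑ k, (deriv (φ k) z * v * conj (ψ k z) + φ k z * conj (deriv (ψ k) z * v))) 0 := by
      refine HasDerivAt.fun_sum fun k _ => ?_
      have := (hcomp (hφ k)).mul (hcomp (hψ k)).star
      simp only [Complex.ofReal_zero, zero_mul, add_zero] at this
      exact this
    have hzero : (fun s : ℝ => ∑ k, φ k (z + (s : ℂ) * v) * conj (ψ k (z + (s : ℂ) * v)))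
        =ᶠ[nhds 0] fun _ => 0 := by
      have : ∀ᶠ s : ℝ in nhds 0, z + (s : ℂ) * v ∈ Ω :=
        hline.continuousAt.eventually_mem (hΩ.mem_nhds (by simpa using hz))
      filter_upwards [this] with s hs using h _ hs
    have h0 := hsum.unique ((hasDerivAt_const (0 : ℝ) (0 : ℂ)).congr_of_eventuallyEq hzero)
    rw [← h0, Finset.mul_sum, Finset.mul_sum, ← Finset.sum_add_distrib]
    refine Finset.sum_congr rfl fun k _ => ?_
    rw [map_mul]; ring
  have h1 := hdir 1
  have hI := hdir Complex.I
  simp only [map_one, Complex.conj_I] at h1 hI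
  have hI2 := Complex.I_mul_I
  linear_combination (1 / 2) * h1 - (Complex.I / 2) * hI
    + (1 / 2) * ((∑ k, deriv (φ k) z * conj (ψ k z))
      - ∑ k, φ k z * conj (deriv (ψ k) z)) * hI2

open ComplexConjugate in
/-- Polarization: if `∑ φₖ(z) conj ψₖ(z)` vanishes on a domain, so does `∑ φₖ(z) conj ψₖ(w)`. -/
lemma sum_mul_conj_polarization {ι : Type*} [Fintype ι] {Ω : Set ℂ} (hΩ : IsOpen Ω)
    (hΩc : IsPreconnected Ω)
    {φ ψ : ι → ℂ → ℂ} (hφ : ∀ k, DifferentiableOn ℂ (φ k) Ω)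
    (hψ : ∀ k, DifferentiableOn ℂ (ψ k) Ω)
    (h : ∀ z ∈ Ω, ∑ k, φ k z * conj (ψ k z) = 0) :
    ∀ z ∈ Ω, ∀ w ∈ Ω, ∑ k, φ k z * conj (ψ k w) = 0 := by
  intro z hz w hw
  have hit : ∀ m : ℕ, (∀ k, DifferentiableOn ℂ (iteratedDeriv m (φ k)) Ω) ∧
      ∀ z ∈ Ω, ∑ k, iteratedDeriv m (φ k) z * conj (ψ k z) = 0 := by
    intro m
    induction m with
    | zero => simpa using ⟨hφ, h⟩
    | succ m ih =>
      simp only [iteratedDeriv_succ]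
      exact ⟨fun k => (ih.1 k).deriv hΩ, sum_deriv_mul_conj_eq_zero hΩ ih.1 hψ ih.2⟩
  have han : AnalyticOnNhd ℂ (fun z => ∑ k, φ k z * conj (ψ k w)) Ω :=
    (DifferentiableOn.fun_sum fun k _ => (hφ k).mul_const _).analyticOnNhd hΩ
  refine han.eqOn_zero_of_preconnected_of_eventuallyEq_zero hΩc hw ?_ hz
  refine analyticOrderAt_eq_top.1 ?_
  rw [ENat.eq_top_iff_forall_ge]
  intro n
  rw [natCast_le_analyticOrderAt_iff_iteratedDeriv_eq_zero (han w hw)]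
  intro m _
  rw [← (hit m).2 w hw, iteratedDeriv_fun_sum]
  · refine Finset.sum_congr rfl fun k _ => ?_
    exact iteratedDeriv_mul_const_field _ _
  · intro k _
    exact (((hφ k).mul_const _).analyticOnNhd hΩ w hw).contDiffAt

/-- Two functions independent over the field, one of which vanishes nowhere, are separated
by a pair of points. -/
lemma exists_det_ne_zero {Ω : Set ℂ} (hne : Ω.Nonempty) {u v : ℂ → ℂ} (hu : ∀ z ∈ Ω, u z ≠ 0)
    (hindep : ¬ ∃ a b : ℂ, (a, b) ≠ (0, 0) ∧ ∀ z ∈ Ω, a * u z + b * v z = 0) :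
    ∃ w₁ ∈ Ω, ∃ w₂ ∈ Ω, u w₁ * v w₂ - u w₂ * v w₁ ≠ 0 := by
  obtain ⟨w₁, hw₁⟩ := hne
  by_contra! hcon
  refine hindep ⟨-v w₁, u w₁, fun h => hu w₁ hw₁ (Prod.ext_iff.1 h).2, fun z hz => ?_⟩
  linear_combination hcon w₁ hw₁ z hz

/-- Cramer's rule for a homogeneous pair of equations. -/
lemma eq_zero_of_det_ne_zero {p q r s x y : ℂ} (hD : p * s - r * q ≠ 0)
    (h₁ : x * p + y * q = 0) (h₂ : x * r + y * s = 0) : x = 0 ∧ y = 0 := by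
  constructor
  · exact (mul_eq_zero.1 (show (p * s - r * q) * x = 0 by
      linear_combination s * h₁ - q * h₂)).resolve_left hD
  · exact (mul_eq_zero.1 (show (p * s - r * q) * y = 0 by
      linear_combination p * h₂ - r * h₁)).resolve_left hD

open ComplexConjugate in
/-- The products `u ū, u v̄, v ū, v v̄` of independent holomorphic `u, v` are independent. -/
lemma sesquilinear_coeff_eq_zero {Ω : Set ℂ} (hΩ : IsOpen Ω) (hΩc : IsPreconnected Ω)
    {u v : ℂ → ℂ} (hu : DifferentiableOn ℂ u Ω) (hv : DifferentiableOn ℂ v Ω)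
    (hD : ∃ w₁ ∈ Ω, ∃ w₂ ∈ Ω, u w₁ * v w₂ - u w₂ * v w₁ ≠ 0) {A B C D : ℂ}
    (h : ∀ z ∈ Ω, A * (u z * conj (u z)) + B * (u z * conj (v z)) + C * (v z * conj (u z))
      + D * (v z * conj (v z)) = 0) : A = 0 ∧ B = 0 ∧ C = 0 ∧ D = 0 := by
  have hpol := sum_mul_conj_polarization hΩ hΩc
    (φ := ![fun z => A * u z + C * v z, fun z => B * u z + D * v z]) (ψ := ![u, v])
    (by
      intro k
      fin_cases k
      · exact (hu.const_mul A).add (hv.const_mul C)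
      · exact (hu.const_mul B).add (hv.const_mul D))
    (by intro k; fin_cases k <;> assumption)
    (by
      intro z hz
      simp only [Fin.sum_univ_two, Matrix.cons_val_zero, Matrix.cons_val_one]
      linear_combination h z hz)
  simp only [Fin.sum_univ_two, Matrix.cons_val_zero, Matrix.cons_val_one] at hpol
  obtain ⟨w₁, hw₁, w₂, hw₂, hD⟩ := hD
  have key : ∀ w ∈ Ω, A * conj (u w) + B * conj (v w) = 0 ∧
      C * conj (u w) + D * conj (v w) = 0 := fun w hw =>
    eq_zero_of_det_ne_zero hD (by linear_combination hpol w₁ hw₁ w hw)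
      (by linear_combination hpol w₂ hw₂ w hw)
  have hD' : conj (u w₁) * conj (v w₂) - conj (u w₂) * conj (v w₁) ≠ 0 := by
    rw [← map_mul, ← map_mul, ← map_sub]
    exact (map_ne_zero _).2 hD
  obtain ⟨hA, hB⟩ := eq_zero_of_det_ne_zero hD' (key w₁ hw₁).1 (key w₂ hw₂).1
  obtain ⟨hC, hD⟩ := eq_zero_of_det_ne_zero hD' (key w₁ hw₁).2 (key w₂ hw₂).2
  exact ⟨hA, hB, hC, hD⟩

open ComplexConjugate in
/-- Holomorphic pairs with the same Jacobian `|f|² - |g|² = |u|² - |v|²` are related by a linear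
transformation when `u, v` are independent. -/
lemma exists_linear_of_jacobian_eq {Ω : Set ℂ} (hΩ : IsOpen Ω) (hΩc : IsPreconnected Ω)
    {u v f g : ℂ → ℂ} (hu : DifferentiableOn ℂ u Ω) (hv : DifferentiableOn ℂ v Ω)
    (hf : DifferentiableOn ℂ f Ω) (hg : DifferentiableOn ℂ g Ω)
    (hD : ∃ w₁ ∈ Ω, ∃ w₂ ∈ Ω, u w₁ * v w₂ - u w₂ * v w₁ ≠ 0)
    (h : ∀ z ∈ Ω, f z * conj (f z) - g z * conj (g z) = u z * conj (u z) - v z * conj (v z)) :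
    ∃ a b c d : ℂ, ∀ z ∈ Ω, f z = a * u z + b * v z ∧ g z = c * u z + d * v z := by
  have hpol := sum_mul_conj_polarization hΩ hΩc
    (φ := ![f, fun z => -g z, fun z => -u z, v]) (ψ := ![f, g, u, v])
    (by intro k; fin_cases k; exacts [hf, hg.neg, hu.neg, hv])
    (by intro k; fin_cases k <;> assumption)
    (by
      intro z hz
      simp [Fin.sum_univ_four]
      linear_combination h z hz)
  replace hpol : ∀ z ∈ Ω, ∀ w ∈ Ω, f z * conj (f w) - g z * conj (g w) =
      u z * conj (u w) - v z * conj (v w) := by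
    intro z hz w hw
    have := hpol z hz w hw
    simp [Fin.sum_univ_four] at this
    linear_combination this
  obtain ⟨w₁, hw₁, w₂, hw₂, hD⟩ := hD
  have hgram : (f w₁ * g w₂ - f w₂ * g w₁) * conj (f w₁ * g w₂ - f w₂ * g w₁) =
      (u w₁ * v w₂ - u w₂ * v w₁) * conj (u w₁ * v w₂ - u w₂ * v w₁) := by
    have h11 := hpol w₁ hw₁ w₁ hw₁
    have h12 := hpol w₁ hw₁ w₂ hw₂
    have h21 := hpol w₂ hw₂ w₁ hw₁
    have h22 := hpol w₂ hw₂ w₂ hw₂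
    simp only [map_sub, map_mul]
    linear_combination -(f w₂ * conj (f w₂) - g w₂ * conj (g w₂)) * h11
      - (u w₁ * conj (u w₁) - v w₁ * conj (v w₁)) * h22
      + (f w₂ * conj (f w₁) - g w₂ * conj (g w₁)) * h12
      + (u w₁ * conj (u w₂) - v w₁ * conj (v w₂)) * h21
  set Δ := conj (f w₁ * g w₂ - f w₂ * g w₁) with hΔ
  have hΔ0 : Δ ≠ 0 := by
    intro h0
    rw [h0, mul_zero] at hgram
    exact mul_ne_zero hD ((map_ne_zero _).2 hD) hgram.symm
  have hΔe : Δ = conj (f w₁) * conj (g w₂) - conj (f w₂) * conj (g w₁) := by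
    rw [hΔ, map_sub, map_mul, map_mul]
  refine ⟨(conj (u w₁) * conj (g w₂) - conj (u w₂) * conj (g w₁)) / Δ,
    -(conj (v w₁) * conj (g w₂) - conj (v w₂) * conj (g w₁)) / Δ,
    (conj (u w₁) * conj (f w₂) - conj (u w₂) * conj (f w₁)) / Δ,
    -(conj (v w₁) * conj (f w₂) - conj (v w₂) * conj (f w₁)) / Δ, fun z hz => ?_⟩
  have h1 := hpol z hz w₁ hw₁
  have h2 := hpol z hz w₂ hw₂
  constructor
  · field_simp
    rw [hΔe]
    linear_combination conj (g w₂) * h1 - conj (g w₁) * h2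
  · field_simp
    rw [hΔe]
    linear_combination conj (f w₂) * h1 - conj (f w₁) * h2

/-- A function on `[0, ∞)` with vanishing derivative is constant. -/
lemma eq_of_hasDerivWithinAt_zero {y : ℝ → ℂ}
    (hy : ∀ t ∈ Ici (0 : ℝ), HasDerivWithinAt y 0 (Ici 0) t) : ∀ t ∈ Ici (0 : ℝ), y t = y 0 := by
  intro t ht
  have := (convex_Ici (0 : ℝ)).norm_image_sub_le_of_norm_hasDerivWithin_le (C := 0) hy
    (fun x _ => by simp) self_mem_Ici ht
  rw [zero_mul] at this
  exact sub_eq_zero.1 (norm_le_zero_iff.1 this)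

/-- The solution of `y' = p y`, `y 0 = 1` on `[0, ∞)`. -/
lemma eq_exp_of_hasDerivWithinAt {y : ℝ → ℂ} {p : ℂ} (h0 : y 0 = 1)
    (hy : ∀ t ∈ Ici (0 : ℝ), HasDerivWithinAt y (p * y t) (Ici 0) t) :
    ∀ t ∈ Ici (0 : ℝ), y t = Complex.exp (p * t) := by
  have hexp : ∀ t : ℝ, HasDerivAt (fun s : ℝ => Complex.exp (-(p * (s : ℂ))))
      (Complex.exp (-(p * (t : ℂ))) * -(p * 1)) t := fun t =>
    ((Complex.ofRealCLM.hasDerivAt (x := t)).const_mul p).neg.cexp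
  have hconst := eq_of_hasDerivWithinAt_zero (y := fun t => y t * Complex.exp (-(p * (t : ℂ))))
    fun t ht => ((hy t ht).mul (hexp t).hasDerivWithinAt).congr_deriv (by ring)
  intro t ht
  have h1 := hconst t ht
  simp only [h0, Complex.ofReal_zero, mul_zero, neg_zero, Complex.exp_zero, mul_one] at h1
  rw [Complex.exp_neg] at h1
  exact (mul_inv_eq_one₀ (Complex.exp_ne_zero _)).1 h1

/-- The fundamental theorem of calculus on `[0, ∞)`. -/
lemma hasDerivWithinAt_integral_Ici {h : ℝ → ℝ} (hh : ContinuousOn h (Ici 0)) :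
    ∀ t ∈ Ici (0 : ℝ),
      HasDerivWithinAt (fun t => ∫ s in (0 : ℝ)..t, h s) (h t) (Ici 0) t := by
  intro t ht
  have hc : Continuous fun s => h (max s 0) :=
    hh.comp_continuous (by fun_prop) fun s => le_max_right s 0
  have hder := (hc.integral_hasStrictDerivAt 0 t).hasDerivAt.hasDerivWithinAt (s := Ici 0)
  rw [max_eq_left ht] at hder
  have heq : ∀ x ∈ Ici (0 : ℝ), (∫ s in (0 : ℝ)..x, h s) = ∫ s in (0 : ℝ)..x, h (max s 0) := by
    intro x hx
    refine intervalIntegral.integral_congr fun s hs => ?_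
    rw [uIcc_of_le hx] at hs
    simp only [max_eq_left hs.1]
  exact hder.congr heq (heq t ht)

open ComplexConjugate in
/-- If `|a|² = 1 + |b|²` and `a' ā - b̄ b'` is the constant `p ∈ iℝ`, then `a` is determined
by `b` and its initial value. -/
lemma eq_sqrt_mul_exp {a b a' b' : ℝ → ℂ} {p : ℂ}
    (ha : ∀ t ∈ Ici (0 : ℝ), HasDerivWithinAt a (a' t) (Ici 0) t)
    (hb : ∀ t ∈ Ici (0 : ℝ), HasDerivWithinAt b (b' t) (Ici 0) t)
    (hb'c : ContinuousOn b' (Ici 0)) (ha0 : a 0 = 1) (hb0 : b 0 = 0)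
    (hnorm : ∀ t ∈ Ici (0 : ℝ), a t * conj (a t) - b t * conj (b t) = 1)
    (hp : ∀ t ∈ Ici (0 : ℝ), a' t * conj (a t) - conj (b t) * b' t = p)
    (hpc : conj p = -p) :
    ∀ t ∈ Ici (0 : ℝ), a t = (Real.sqrt (1 + ‖b t‖ ^ 2) : ℂ) *
      Complex.exp (Complex.I * ((∫ s in (0 : ℝ)..t,
        (p.im + (derivWithin b (Ici 0) s * conj (b s)).im) / (1 + ‖b s‖ ^ 2)) : ℝ)) := by
  have hbc : ContinuousOn b (Ici 0) := fun t ht => (hb t ht).continuousWithinAt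
  have hbd : ∀ s ∈ Ici (0 : ℝ), derivWithin b (Ici 0) s = b' s := fun s hs =>
    (hb s hs).derivWithin (uniqueDiffOn_Ici 0 s hs)
  have hpos : ∀ s, 0 < 1 + ‖b s‖ ^ 2 := fun s => by positivity
  set Φ : ℝ → ℝ := fun t => ∫ s in (0 : ℝ)..t,
    (p.im + (derivWithin b (Ici 0) s * conj (b s)).im) / (1 + ‖b s‖ ^ 2) with hΦ
  set r : ℝ → ℝ := fun t => Real.sqrt (1 + ‖b t‖ ^ 2) with hr
  have hΦd : ∀ t ∈ Ici (0 : ℝ), HasDerivWithinAt Φ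
      ((p.im + (b' t * conj (b t)).im) / (1 + ‖b t‖ ^ 2)) (Ici 0) t := by
    intro t ht
    have hcont : ContinuousOn (fun s =>
        (p.im + (derivWithin b (Ici 0) s * conj (b s)).im) / (1 + ‖b s‖ ^ 2)) (Ici 0) := by
      refine ContinuousOn.div ?_ (by fun_prop) fun s _ => (hpos s).ne'
      refine continuousOn_const.add (Complex.continuous_im.comp_continuousOn ?_)
      exact (hb'c.congr hbd).mul (Complex.continuous_conj.comp_continuousOn hbc)
    have := hasDerivWithinAt_integral_Ici hcont t ht
    rwa [hbd t ht] at this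
  have hrd : ∀ t ∈ Ici (0 : ℝ), HasDerivWithinAt r
      ((b' t * conj (b t)).re / r t) (Ici 0) t := by
    intro t ht
    have h1 : HasDerivWithinAt (fun s => ‖b s‖ ^ 2) (2 * (b' t * conj (b t)).re) (Ici 0) t := by
      have := (hb t ht).norm_sq
      refine this.congr_deriv ?_
      rw [Complex.inner]
    have h2 := (h1.const_add 1).sqrt (hpos t).ne'
    refine h2.congr_deriv ?_
    have : Real.sqrt (1 + ‖b t‖ ^ 2) ≠ 0 := (Real.sqrt_pos.2 (hpos t)).ne'
    simp only [hr]
    field_simp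
  have hr0 : ∀ t, (r t : ℂ) ≠ 0 := fun t =>
    Complex.ofReal_ne_zero.2 (Real.sqrt_pos.2 (hpos t)).ne'
  have hrsq : ∀ t, (r t : ℂ) * r t = 1 + b t * conj (b t) := by
    intro t
    rw [← Complex.ofReal_mul, hr, Real.mul_self_sqrt (hpos t).le, Complex.mul_conj']
    push_cast; ring
  have hpI : p = p.im * Complex.I := by
    have hre : p.re = 0 := by
      have := congrArg Complex.re hpc
      simp at this
      linarith
    apply Complex.ext <;> simp [hre]
  have hconst := eq_of_hasDerivWithinAt_zero
    (y := fun t => a t * Complex.exp (-(Complex.I * (Φ t : ℂ))) / (r t : ℂ)) (by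
      intro t ht
      have hΦe : HasDerivWithinAt (fun t => Complex.exp (-(Complex.I * (Φ t : ℂ))))
          (Complex.exp (-(Complex.I * (Φ t : ℂ))) * -(Complex.I *
            (((p.im + (b' t * conj (b t)).im) / (1 + ‖b t‖ ^ 2) : ℝ) : ℂ))) (Ici 0) t :=
        ((hΦd t ht).ofReal_comp.const_mul Complex.I).neg.cexp
      refine (((ha t ht).mul hΦe).div (hrd t ht).ofReal_comp (hr0 t)).congr_deriv ?_
      refine div_eq_zero_iff.2 (Or.inl ?_)
      simp only [Pi.mul_apply]
      have hq : (1 : ℂ) + ‖b t‖ ^ 2 = r t * r t := by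
        rw [hrsq, Complex.mul_conj']
      push_cast
      rw [hq]
      have hsplit : conj (b t) * b' t =
          (b' t * conj (b t)).re + (b' t * conj (b t)).im * Complex.I := by
        rw [Complex.re_add_im, mul_comm]
      have ha' : a' t * (r t * r t) = a t * (conj (b t) * b' t + p) := by
        linear_combination a' t * hrsq t + a t * hp t ht - a' t * hnorm t ht
      rw [hsplit, hpI] at ha'
      have hrt := hr0 t
      field_simp
      linear_combination Complex.exp (-(Complex.I * (Φ t : ℂ))) * ha')
  intro t ht
  have h1 := hconst t ht
  have hr00 : r 0 = 1 := by simp [hr, hb0]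
  have hΦ0 : Φ 0 = 0 := by simp [hΦ]
  simp only [ha0, hr00, hΦ0, Complex.ofReal_zero, mul_zero, neg_zero, Complex.exp_zero, mul_one,
    Complex.ofReal_one, div_one] at h1
  rw [div_eq_one_iff_eq (hr0 t), Complex.exp_neg, ← div_eq_mul_inv,
    div_eq_iff (Complex.exp_ne_zero _)] at h1
  exact h1

open ComplexConjugate in
/-- Entries of a matrix `(a b; c d)` preserving `|x|² - |y|²`, in terms of its determinant. -/
lemma indefinite_unitary_entries {a b c d : ℂ} (h₁ : a * conj a - c * conj c = 1)
    (h₂ : a * conj b - c * conj d = 0) (h₃ : d * conj d - b * conj b = 1) :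
    d = (a * d - b * c) * conj a ∧ c = (a * d - b * c) * conj b ∧
      (a * d - b * c) * conj (a * d - b * c) = 1 ∧ a * conj a - b * conj b = 1 := by
  have h₂' : conj a * b - conj c * d = 0 := by simpa using congrArg conj h₂
  have hd : d = (a * d - b * c) * conj a := by linear_combination -d * h₁ + c * h₂'
  have hc : c = (a * d - b * c) * conj b := by linear_combination -c * h₃ - d * h₂
  have hdet : (a * d - b * c) * conj (a * d - b * c) = 1 := by
    simp only [map_sub, map_mul]
    linear_combination (d * conj d - b * conj b) * h₁ + h₃ + (conj a * b - conj c * d) * h₂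
  refine ⟨hd, hc, hdet, ?_⟩
  have hd' := congrArg conj hd
  rw [map_mul, Complex.conj_conj] at hd'
  set E := a * d - b * c
  have h3' : E * conj E * (a * conj a) - b * conj b = 1 := by
    linear_combination h₃ - conj d * hd - E * conj a * hd'
  rw [hdet] at h3'
  linear_combination h3'

open ComplexConjugate in
/-- The evolution of a matrix `(a b; c d)` preserving `|x|² - |y|²` for which the quantities
appearing in the governing equation are conserved. -/
lemma indefinite_unitary_evolution {a b c d a' b' c' d' : ℝ → ℂ} {p s : ℂ}
    (ha : ∀ t ∈ Ici (0 : ℝ), HasDerivWithinAt a (a' t) (Ici 0) t)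
    (hb : ∀ t ∈ Ici (0 : ℝ), HasDerivWithinAt b (b' t) (Ici 0) t)
    (hc : ∀ t ∈ Ici (0 : ℝ), HasDerivWithinAt c (c' t) (Ici 0) t)
    (hd : ∀ t ∈ Ici (0 : ℝ), HasDerivWithinAt d (d' t) (Ici 0) t)
    (ha0 : a 0 = 1) (hb0 : b 0 = 0) (hd0 : d 0 = 1)
    (h₁ : ∀ t ∈ Ici (0 : ℝ), a t * conj (a t) - c t * conj (c t) = 1)
    (h₂ : ∀ t ∈ Ici (0 : ℝ), a t * conj (b t) - c t * conj (d t) = 0)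
    (h₃ : ∀ t ∈ Ici (0 : ℝ), d t * conj (d t) - b t * conj (b t) = 1)
    (hp : ∀ t ∈ Ici (0 : ℝ), a' t * conj (a t) - c t * conj (c' t) = p)
    (hq : ∀ t ∈ Ici (0 : ℝ), a' t * conj (b t) - c t * conj (d' t) = 0)
    (hs : ∀ t ∈ Ici (0 : ℝ), b' t * conj (b t) - d t * conj (d' t) = s) :
    conj p = -p ∧
    ((∀ t ∈ Ici (0 : ℝ), c t = conj (b t) ∧ d t = conj (a t) ∧
        a t * conj (a t) - b t * conj (b t) = 1 ∧ a' t * conj (a t) - conj (b t) * b' t = p) ∨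
      (p.im + s.im ≠ 0 ∧ ∀ t ∈ Ici (0 : ℝ), b t = 0 ∧ c t = 0 ∧
        a t = Complex.exp (Complex.I * (p.im : ℂ) * (t : ℂ)) ∧
        d t = Complex.exp (Complex.I * (s.im : ℂ) * (t : ℂ)))) := by
  have hud : ∀ t ∈ Ici (0 : ℝ), UniqueDiffWithinAt ℝ (Ici (0 : ℝ)) t := uniqueDiffOn_Ici 0
  have h00 : (0 : ℝ) ∈ Ici (0 : ℝ) := self_mem_Ici
  have hderiv_eq : ∀ {x y : ℝ → ℂ} {x' y' : ℂ} {t : ℝ}, t ∈ Ici (0 : ℝ) →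
      HasDerivWithinAt x x' (Ici 0) t → HasDerivWithinAt y y' (Ici 0) t →
      (∀ t ∈ Ici (0 : ℝ), x t = y t) → x' = y' := fun ht hx hy hxy =>
    (hud _ ht).eq_deriv _ hx (hy.congr hxy (hxy _ ht))
  have hskew : ∀ {x y x' y' : ℝ → ℂ} {k : ℂ},
      (∀ t ∈ Ici (0 : ℝ), HasDerivWithinAt x (x' t) (Ici 0) t) →
      (∀ t ∈ Ici (0 : ℝ), HasDerivWithinAt y (y' t) (Ici 0) t) →
      (∀ t ∈ Ici (0 : ℝ), x t * conj (x t) - y t * conj (y t) = k) →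
      conj (x' 0 * conj (x 0) - y 0 * conj (y' 0)) = -(x' 0 * conj (x 0) - y 0 * conj (y' 0)) := by
    intro x y x' y' k hx hy hxy
    have := hderiv_eq h00 (((hx 0 h00).mul (hx 0 h00).star).sub ((hy 0 h00).mul (hy 0 h00).star))
      (hasDerivWithinAt_const 0 (Ici 0) k) hxy
    simp only [map_sub, map_mul, Complex.conj_conj]
    simp only [Complex.star_def] at this
    linear_combination this
  have hpc : conj p = -p := by rw [← hp 0 h00]; exact hskew ha hc h₁
  have hsc : conj s = -s := by
    rw [← hs 0 h00]
    exact hskew (k := -1) hb hd fun t ht => by linear_combination -h₃ t ht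
  refine ⟨hpc, ?_⟩
  have him : ∀ {k : ℂ}, conj k = -k → k = Complex.I * (k.im : ℂ) := by
    intro k hk
    have hre : k.re = 0 := by
      have := congrArg Complex.re hk
      simp only [Complex.conj_re, Complex.neg_re] at this
      linarith
    apply Complex.ext <;> simp [hre]
  set E : ℝ → ℂ := fun t => a t * d t - b t * c t with hE
  set E' : ℝ → ℂ := fun t => a' t * d t + a t * d' t - (b' t * c t + b t * c' t) with hE'
  have hEd : ∀ t ∈ Ici (0 : ℝ), HasDerivWithinAt E (E' t) (Ici 0) t := fun t ht =>
    ((ha t ht).mul (hd t ht)).sub ((hb t ht).mul (hc t ht))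
  have hent := fun t ht => indefinite_unitary_entries (h₁ t ht) (h₂ t ht) (h₃ t ht)
  have hdE : ∀ t ∈ Ici (0 : ℝ), d t = E t * conj (a t) := fun t ht => (hent t ht).1
  have hcE : ∀ t ∈ Ici (0 : ℝ), c t = E t * conj (b t) := fun t ht => (hent t ht).2.1
  have hEE : ∀ t ∈ Ici (0 : ℝ), E t * conj (E t) = 1 := fun t ht => (hent t ht).2.2.1
  have hab : ∀ t ∈ Ici (0 : ℝ), a t * conj (a t) - b t * conj (b t) = 1 :=
    fun t ht => (hent t ht).2.2.2
  have hd'E : ∀ t ∈ Ici (0 : ℝ), d' t = E' t * conj (a t) + E t * conj (a' t) := fun t ht =>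
    hderiv_eq ht (hd t ht) ((hEd t ht).mul (ha t ht).star) hdE
  have hc'E : ∀ t ∈ Ici (0 : ℝ), c' t = E' t * conj (b t) + E t * conj (b' t) := fun t ht =>
    hderiv_eq ht (hc t ht) ((hEd t ht).mul (hb t ht).star) hcE
  have hps : ∀ t ∈ Ici (0 : ℝ),
      -(E t * conj (E' t)) * (a t * conj (a t) + b t * conj (b t)) = p + s := by
    intro t ht
    rw [← hp t ht, ← hs t ht, hdE t ht, hcE t ht, hd'E t ht, hc'E t ht]
    simp only [map_add, map_mul, Complex.conj_conj]
    linear_combination (conj (a t) * a' t + conj (b t) * b' t) * hEE t ht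
  have hqE : ∀ t ∈ Ici (0 : ℝ), E t * conj (E' t) * (a t * conj (b t)) = 0 := by
    intro t ht
    have := hq t ht
    rw [hcE t ht, hd'E t ht] at this
    simp only [map_add, map_mul, Complex.conj_conj] at this
    linear_combination -this - (a' t * conj (b t)) * hEE t ht
  have hE0 : ∀ t ∈ Ici (0 : ℝ), E t ≠ 0 := fun t ht h => by simpa [h] using hEE t ht
  have hnormpos : ∀ t ∈ Ici (0 : ℝ), a t * conj (a t) + b t * conj (b t) ≠ 0 := by
    intro t ht h
    have h2 := hab t ht
    rw [Complex.mul_conj', Complex.mul_conj'] at h h2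
    norm_cast at h h2
    nlinarith [sq_nonneg ‖a t‖, sq_nonneg ‖b t‖]
  have ha_ne : ∀ t ∈ Ici (0 : ℝ), a t ≠ 0 := by
    intro t ht h
    have h2 := hab t ht
    rw [Complex.mul_conj', Complex.mul_conj', h] at h2
    norm_cast at h2
    simp at h2
    nlinarith [sq_nonneg ‖b t‖]
  by_cases hlam : p + s = 0
  · left
    have hE'0 : ∀ t ∈ Ici (0 : ℝ), E' t = 0 := by
      intro t ht
      have := hps t ht
      rw [hlam] at this
      simpa [hnormpos t ht, hE0 t ht] using this
    have hE1 : ∀ t ∈ Ici (0 : ℝ), E t = 1 := by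
      intro t ht
      rw [eq_of_hasDerivWithinAt_zero (fun t ht => (hEd t ht).congr_deriv (hE'0 t ht)) t ht]
      simp [hE, ha0, hb0, hd0]
    intro t ht
    have hct : c t = conj (b t) := by rw [hcE t ht, hE1 t ht, one_mul]
    refine ⟨hct, by rw [hdE t ht, hE1 t ht, one_mul], hab t ht, ?_⟩
    have := hp t ht
    rw [hct, hc'E t ht, hE1 t ht, hE'0 t ht] at this
    simpa using this
  · right
    have hb_zero : ∀ t ∈ Ici (0 : ℝ), b t = 0 := by
      intro t ht
      have hne : E t * conj (E' t) ≠ 0 := by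
        intro h
        have := hps t ht
        rw [h, neg_zero, zero_mul] at this
        exact hlam this.symm
      simpa [hne, ha_ne t ht] using hqE t ht
    have hc_zero : ∀ t ∈ Ici (0 : ℝ), c t = 0 := fun t ht => by
      rw [hcE t ht, hb_zero t ht, map_zero, mul_zero]
    have ha_exp := eq_exp_of_hasDerivWithinAt ha0 (p := p) fun t ht =>
      (ha t ht).congr_deriv (by
        have h2 := hp t ht
        have h3 := h₁ t ht
        rw [hc_zero t ht] at h2 h3
        linear_combination a t * h2 - a' t * h3)
    have hd_exp := eq_exp_of_hasDerivWithinAt hd0 (p := s) fun t ht =>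
      (hd t ht).congr_deriv (by
        have h2 := congrArg conj (hs t ht)
        have h3 := h₃ t ht
        rw [hb_zero t ht] at h2 h3
        simp only [map_sub, map_mul, Complex.conj_conj, map_zero, mul_zero, hsc] at h2
        linear_combination -d t * h2 - d' t * h3)
    refine ⟨fun h => hlam ?_, fun t ht => ⟨hb_zero t ht, hc_zero t ht, ?_, ?_⟩⟩
    · rw [him hpc, him hsc, ← mul_add, ← Complex.ofReal_add, h, Complex.ofReal_zero, mul_zero]
    · rw [← him hpc, ha_exp t ht]
    · rw [← him hsc, hd_exp t ht]

/-- **Theorem (solutions with harmonic labellings, linearly independent case).** If the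
initial univalent sense preserving labelling `F₀ + conj G₀` has `F₀', G₀'` linearly
independent over `ℂ`, and `f = ∂F/∂z`, `g = ∂G/∂z` solve the governing equation
`f_t conj f − g conj g_t = i ν(z, conj z)` with `f(t,·), g(t,·)` not identically zero,
then either (i) `f = √(1+|β|²) e^{iΦ} F₀' + β G₀'`,
`g = conj(β) F₀' + √(1+|β|²) e^{−iΦ} G₀'` with
`Φ(t) = ∫₀ᵗ (ν₀ + Im(β' conj β))/(1+|β|²)` for some `C¹` `β` with `β(0) = 0` and `ν₀ ∈ ℝ`,
or (ii) `f = e^{iν₀t} F₀'`, `g = e^{i(ξ₀−ν₀)t} G₀'` for some `ν₀ ∈ ℝ` and `ξ₀ ∈ ℝ \ {0}`. -/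
theorem stmt_7 (Ω₀ : Set ℂ) (hΩne : Ω₀.Nonempty) (hΩo : IsOpen Ω₀) (hΩc : IsConnected Ω₀)
    (hΩsc : SimplyConnectedSpace Ω₀)
    (F₀ G₀ : ℂ → ℂ)
    (hF₀ : DifferentiableOn ℂ F₀ Ω₀) (hG₀ : DifferentiableOn ℂ G₀ Ω₀)
    (huniv : Set.InjOn (fun z => F₀ z + (starRingEnd ℂ) (G₀ z)) Ω₀)
    (hsp : ∀ z ∈ Ω₀, 0 < ‖deriv F₀ z‖ ^ 2 - ‖deriv G₀ z‖ ^ 2)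
    (hindep : ¬ ∃ a b : ℂ, (a, b) ≠ (0, 0) ∧
      ∀ z ∈ Ω₀, a * deriv F₀ z + b * deriv G₀ z = 0)
    (F G f g ft gt : ℝ → ℂ → ℂ)
    (hF : ∀ t ∈ Ici (0:ℝ), DifferentiableOn ℂ (F t) Ω₀)
    (hG : ∀ t ∈ Ici (0:ℝ), DifferentiableOn ℂ (G t) Ω₀)
    (hf : ∀ t ∈ Ici (0:ℝ), ∀ z ∈ Ω₀, f t z = deriv (F t) z)
    (hg : ∀ t ∈ Ici (0:ℝ), ∀ z ∈ Ω₀, g t z = deriv (G t) z)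
    (hftd : ∀ z ∈ Ω₀, ∀ t ∈ Ici (0:ℝ),
      HasDerivWithinAt (fun s => f s z) (ft t z) (Ici 0) t)
    (hgtd : ∀ z ∈ Ω₀, ∀ t ∈ Ici (0:ℝ),
      HasDerivWithinAt (fun s => g s z) (gt t z) (Ici 0) t)
    (hftc : ∀ z ∈ Ω₀, ContinuousOn (fun t => ft t z) (Ici 0))
    (hgtc : ∀ z ∈ Ω₀, ContinuousOn (fun t => gt t z) (Ici 0))
    (hF0 : ∀ z ∈ Ω₀, F 0 z = F₀ z) (hG0 : ∀ z ∈ Ω₀, G 0 z = G₀ z)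
    (ν : ℂ → ℝ)
    (hgov : ∀ t ∈ Ici (0:ℝ), ∀ z ∈ Ω₀,
      ft t z * (starRingEnd ℂ) (f t z) - g t z * (starRingEnd ℂ) (gt t z)
        = Complex.I * (ν z : ℂ))
    (hfne : ∀ t ∈ Ici (0:ℝ), ∃ z ∈ Ω₀, f t z ≠ 0)
    (hgne : ∀ t ∈ Ici (0:ℝ), ∃ z ∈ Ω₀, g t z ≠ 0) :
    (∃ (β : ℝ → ℂ) (ν₀ : ℝ), ContDiffOn ℝ 1 β (Ici 0) ∧ β 0 = 0 ∧
      ∀ t ∈ Ici (0:ℝ), ∀ z ∈ Ω₀,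
        f t z = (Real.sqrt (1 + ‖β t‖ ^ 2) : ℂ) *
              Complex.exp (Complex.I * ((∫ s in (0:ℝ)..t,
                (ν₀ + (derivWithin β (Ici 0) s * (starRingEnd ℂ) (β s)).im)
                  / (1 + ‖β s‖ ^ 2)) : ℝ)) * deriv F₀ z
            + β t * deriv G₀ z ∧
        g t z = (starRingEnd ℂ) (β t) * deriv F₀ z
            + (Real.sqrt (1 + ‖β t‖ ^ 2) : ℂ) *
              Complex.exp (-(Complex.I * ((∫ s in (0:ℝ)..t,
                (ν₀ + (derivWithin β (Ici 0) s * (starRingEnd ℂ) (β s)).im)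
                  / (1 + ‖β s‖ ^ 2)) : ℝ))) * deriv G₀ z)
    ∨ (∃ ν₀ ξ₀ : ℝ, ξ₀ ≠ 0 ∧
      ∀ t ∈ Ici (0:ℝ), ∀ z ∈ Ω₀,
        f t z = Complex.exp (Complex.I * (ν₀ : ℂ) * (t : ℂ)) * deriv F₀ z ∧
        g t z = Complex.exp (Complex.I * ((ξ₀ : ℂ) - (ν₀ : ℂ)) * (t : ℂ)) * deriv G₀ z) := by
  set u : ℂ → ℂ := deriv F₀ with hu_def
  set v : ℂ → ℂ := deriv G₀ with hv_def
  have hu : DifferentiableOn ℂ u Ω₀ := hF₀.deriv hΩo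
  have hv : DifferentiableOn ℂ v Ω₀ := hG₀.deriv hΩo
  have hpc : IsPreconnected Ω₀ := hΩc.isPreconnected
  have hu0 : ∀ z ∈ Ω₀, u z ≠ 0 := by
    intro z hz h
    have := hsp z hz
    rw [h, norm_zero] at this
    nlinarith [sq_nonneg ‖v z‖]
  have hdet := exists_det_ne_zero hΩne hu0 hindep
  have h00 : (0 : ℝ) ∈ Ici (0 : ℝ) := self_mem_Ici
  have hf0 : ∀ z ∈ Ω₀, f 0 z = u z := fun z hz => by
    rw [hf 0 h00 z hz]
    exact Filter.EventuallyEq.deriv_eq (Filter.eventuallyEq_of_mem (hΩo.mem_nhds hz) hF0)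
  have hg0 : ∀ z ∈ Ω₀, g 0 z = v z := fun z hz => by
    rw [hg 0 h00 z hz]
    exact Filter.EventuallyEq.deriv_eq (Filter.eventuallyEq_of_mem (hΩo.mem_nhds hz) hG0)
  have hfhol : ∀ t ∈ Ici (0 : ℝ), DifferentiableOn ℂ (f t) Ω₀ := fun t ht =>
    ((hF t ht).deriv hΩo).congr (hf t ht)
  have hghol : ∀ t ∈ Ici (0 : ℝ), DifferentiableOn ℂ (g t) Ω₀ := fun t ht =>
    ((hG t ht).deriv hΩo).congr (hg t ht)
  have hjac : ∀ t ∈ Ici (0 : ℝ), ∀ z ∈ Ω₀,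
      f t z * (starRingEnd ℂ) (f t z) - g t z * (starRingEnd ℂ) (g t z) =
        u z * (starRingEnd ℂ) (u z) - v z * (starRingEnd ℂ) (v z) := by
    intro t ht z hz
    have hconst := eq_of_hasDerivWithinAt_zero
      (y := fun t => f t z * (starRingEnd ℂ) (f t z) - g t z * (starRingEnd ℂ) (g t z))
      (fun t ht => by
        have hft := hftd z hz t ht
        have hgt := hgtd z hz t ht
        refine ((hft.mul hft.star).sub (hgt.mul hgt.star)).congr_deriv ?_
        have h1 := hgov t ht z hz
        have h2 := congrArg (starRingEnd ℂ) h1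
        simp only [map_sub, map_mul, Complex.conj_conj, Complex.conj_I, Complex.conj_ofReal] at h2
        simp only [Complex.star_def]
        linear_combination h1 + h2) t ht
    simpa only [hf0 z hz, hg0 z hz] using hconst
  have hlin : ∀ t, ∃ a b c d : ℂ, t ∈ Ici (0 : ℝ) →
      ∀ z ∈ Ω₀, f t z = a * u z + b * v z ∧ g t z = c * u z + d * v z := by
    intro t
    by_cases ht : t ∈ Ici (0 : ℝ)
    · obtain ⟨a, b, c, d, h⟩ := exists_linear_of_jacobian_eq hΩo hpc hu hv (hfhol t ht)
        (hghol t ht) hdet (hjac t ht)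
      exact ⟨a, b, c, d, fun _ => h⟩
    · exact ⟨0, 0, 0, 0, fun h => absurd h ht⟩
  choose a b c d hlin using hlin
  obtain ⟨w₁, hw₁, w₂, hw₂, hD⟩ := id hdet
  set D := u w₁ * v w₂ - u w₂ * v w₁ with hD_def
  have hcoef : ∀ {x y : ℂ} {h : ℂ → ℂ}, (∀ z ∈ Ω₀, h z = x * u z + y * v z) →
      x = (h w₁ * v w₂ - h w₂ * v w₁) / D ∧ y = (h w₂ * u w₁ - h w₁ * u w₂) / D := by
    intro x y h hh
    rw [eq_div_iff hD, eq_div_iff hD, hh w₁ hw₁, hh w₂ hw₂, hD_def]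
    constructor <;> ring
  have hevol : ∀ {h hdot : ℝ → ℂ → ℂ} {x y : ℝ → ℂ},
      (∀ z ∈ Ω₀, ∀ t ∈ Ici (0 : ℝ), HasDerivWithinAt (fun s => h s z) (hdot t z) (Ici 0) t) →
      (∀ z ∈ Ω₀, ContinuousOn (fun t => hdot t z) (Ici 0)) →
      (∀ t ∈ Ici (0 : ℝ), ∀ z ∈ Ω₀, h t z = x t * u z + y t * v z) →
      ∃ x' y' : ℝ → ℂ, ContinuousOn y' (Ici 0) ∧
        (∀ t ∈ Ici (0 : ℝ), HasDerivWithinAt x (x' t) (Ici 0) t) ∧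
        (∀ t ∈ Ici (0 : ℝ), HasDerivWithinAt y (y' t) (Ici 0) t) ∧
        ∀ t ∈ Ici (0 : ℝ), ∀ z ∈ Ω₀, hdot t z = x' t * u z + y' t * v z := by
    intro h hdot x y hd hc hxy
    have hx : ∀ t ∈ Ici (0 : ℝ), HasDerivWithinAt x
        ((hdot t w₁ * v w₂ - hdot t w₂ * v w₁) / D) (Ici 0) t := fun t ht =>
      ((((hd w₁ hw₁ t ht).mul_const (v w₂)).sub
        ((hd w₂ hw₂ t ht).mul_const (v w₁))).div_const D).congr
        (fun s hs => (hcoef (hxy s hs)).1) (hcoef (hxy t ht)).1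
    have hy : ∀ t ∈ Ici (0 : ℝ), HasDerivWithinAt y
        ((hdot t w₂ * u w₁ - hdot t w₁ * u w₂) / D) (Ici 0) t := fun t ht =>
      ((((hd w₂ hw₂ t ht).mul_const (u w₁)).sub
        ((hd w₁ hw₁ t ht).mul_const (u w₂))).div_const D).congr
        (fun s hs => (hcoef (hxy s hs)).2) (hcoef (hxy t ht)).2
    refine ⟨_, _, ?_, hx, hy, fun t ht z hz => ?_⟩
    · exact (((hc w₂ hw₂).mul continuousOn_const).sub
        ((hc w₁ hw₁).mul continuousOn_const)).div_const D
    · exact (uniqueDiffOn_Ici 0 t ht).eq_deriv _ (hd z hz t ht)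
        ((((hx t ht).mul_const (u z)).add ((hy t ht).mul_const (v z))).congr
          (fun s hs => hxy s hs z hz) (hxy t ht z hz))
  obtain ⟨a', b', hb'c, ha, hb, hft⟩ := hevol hftd hftc fun t ht z hz => (hlin t ht z hz).1
  obtain ⟨c', d', _, hc, hd, hgt⟩ := hevol hgtd hgtc fun t ht z hz => (hlin t ht z hz).2
  have hinit : a 0 = 1 ∧ b 0 = 0 ∧ c 0 = 0 ∧ d 0 = 1 := by
    have h1 := hcoef fun z hz => (hlin 0 h00 z hz).1
    have h2 := hcoef fun z hz => (hlin 0 h00 z hz).2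
    have h3 := hcoef (x := 1) (y := 0) (h := f 0) fun z hz => by rw [hf0 z hz]; ring
    have h4 := hcoef (x := 0) (y := 1) (h := g 0) fun z hz => by rw [hg0 z hz]; ring
    exact ⟨h1.1.trans h3.1.symm, h1.2.trans h3.2.symm, h2.1.trans h4.1.symm,
      h2.2.trans h4.2.symm⟩
  obtain ⟨ha0, hb0, hc0, hd0⟩ := hinit
  have hunit : ∀ t ∈ Ici (0 : ℝ),
      a t * (starRingEnd ℂ) (a t) - c t * (starRingEnd ℂ) (c t) - 1 = 0 ∧
      a t * (starRingEnd ℂ) (b t) - c t * (starRingEnd ℂ) (d t) = 0 ∧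
      b t * (starRingEnd ℂ) (a t) - d t * (starRingEnd ℂ) (c t) = 0 ∧
      b t * (starRingEnd ℂ) (b t) - d t * (starRingEnd ℂ) (d t) + 1 = 0 := by
    intro t ht
    refine sesquilinear_coeff_eq_zero hΩo hpc hu hv hdet fun z hz => ?_
    have := hjac t ht z hz
    rw [(hlin t ht z hz).1, (hlin t ht z hz).2] at this
    simp only [map_add, map_mul] at this
    linear_combination this
  have hcons : ∀ t ∈ Ici (0 : ℝ),
      a' t * (starRingEnd ℂ) (a t) - c t * (starRingEnd ℂ) (c' t) - a' 0 = 0 ∧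
      a' t * (starRingEnd ℂ) (b t) - c t * (starRingEnd ℂ) (d' t) = 0 ∧
      b' t * (starRingEnd ℂ) (a t) - d t * (starRingEnd ℂ) (c' t)
        - (b' 0 - (starRingEnd ℂ) (c' 0)) = 0 ∧
      b' t * (starRingEnd ℂ) (b t) - d t * (starRingEnd ℂ) (d' t)
        - -(starRingEnd ℂ) (d' 0) = 0 := by
    intro t ht
    refine sesquilinear_coeff_eq_zero hΩo hpc hu hv hdet fun z hz => ?_
    have h1 := hgov t ht z hz
    have h2 := hgov 0 h00 z hz
    rw [hft t ht z hz, hgt t ht z hz, (hlin t ht z hz).1, (hlin t ht z hz).2] at h1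
    rw [hft 0 h00 z hz, hgt 0 h00 z hz, hf0 z hz, hg0 z hz] at h2
    simp only [map_add, map_mul] at h1 h2
    linear_combination h1 - h2
  obtain ⟨hpconj, hcase⟩ := indefinite_unitary_evolution ha hb hc hd ha0 hb0 hd0
    (fun t ht => sub_eq_zero.1 (hunit t ht).1) (fun t ht => (hunit t ht).2.1)
    (fun t ht => by linear_combination -(hunit t ht).2.2.2)
    (fun t ht => sub_eq_zero.1 (hcons t ht).1) (fun t ht => (hcons t ht).2.1)
    (fun t ht => sub_eq_zero.1 (hcons t ht).2.2.2)
  rcases hcase with hcase | ⟨hne, hcase⟩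
  · left
    have hbd : ∀ s ∈ Ici (0 : ℝ), derivWithin b (Ici 0) s = b' s := fun s hs =>
      (hb s hs).derivWithin (uniqueDiffOn_Ici 0 s hs)
    have hbC : ContDiffOn ℝ 1 b (Ici 0) :=
      (contDiffOn_one_iff_derivWithin (uniqueDiffOn_Ici 0)).2
        ⟨fun t ht => (hb t ht).differentiableWithinAt, hb'c.congr hbd⟩
    have haexp := eq_sqrt_mul_exp ha hb hb'c ha0 hb0 (fun t ht => (hcase t ht).2.2.1)
      (fun t ht => (hcase t ht).2.2.2) hpconj
    refine ⟨b, (a' 0).im, hbC, hb0, fun t ht z hz => ⟨?_, ?_⟩⟩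
    · rw [(hlin t ht z hz).1, haexp t ht]
    · rw [(hlin t ht z hz).2, (hcase t ht).1, (hcase t ht).2.1, haexp t ht, map_mul,
        ← Complex.exp_conj, map_mul, Complex.conj_I, Complex.conj_ofReal, Complex.conj_ofReal,
        neg_mul]
  · right
    refine ⟨(a' 0).im, (a' 0).im + (-(starRingEnd ℂ) (d' 0)).im, hne, fun t ht z hz => ?_⟩
    obtain ⟨hbt, hct, hat, hdt⟩ := hcase t ht
    rw [(hlin t ht z hz).1, (hlin t ht z hz).2, hbt, hct, hat, hdt]
    refine ⟨by ring, ?_⟩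
    rw [Complex.ofReal_add, add_sub_cancel_left]
    ring
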